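/- Every face of the Voronoi polytope Vor_Γ equals F(T,φ) for a uniquely determined element (T,φ) ∈ OP_Γ. -/

import Mathlib

/-!
Serre-style finite graphs: a vertex type `V`, an oriented-edge type `E` with a
fixed-point-free involution `inv` (edge reversal) and source/target maps `s, t`
with `s (inv e) = t e`.  An unoriented edge is an `inv`-orbit `{e, inv e}`;
subsets of unoriented edges are encoded as `inv`-closed subsets of `E`, and an
orientation of a spanning subgraph `Γ∖T` is encoded by the set `O` of its
positively oriented edges.  1-chains with coefficients in `A` are encoded as
functions `c : E → A` with `c (inv e) = - c e` (so that `(c, e⃗) = c e` for the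
standard bilinear form).
-/

structure SerreGraph where
  V : Type
  E : Type
  [fintypeV : Fintype V]
  [fintypeE : Fintype E]
  [decEqV : DecidableEq V]
  [decEqE : DecidableEq E]
  inv : E → E
  s : E → V
  t : E → V
  inv_inv : ∀ e, inv (inv e) = e
  inv_ne : ∀ e, inv e ≠ e
  s_inv : ∀ e, s (inv e) = t e

attribute [instance] SerreGraph.fintypeV SerreGraph.fintypeE
attribute [instance] SerreGraph.decEqV SerreGraph.decEqE

namespace SerreGraph

variable (Γ : SerreGraph)

/-- Reachability between vertices in the spanning subgraph whose allowed oriented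
edges are those in `A`. -/
def Reach (A : Set Γ.E) : Γ.V → Γ.V → Prop :=
  Relation.ReflTransGen (fun a b => ∃ e ∈ A, Γ.s e = a ∧ Γ.t e = b)

/-- The number of connected components of the spanning subgraph with allowed
oriented edges `A`. -/
noncomputable def numComponents (A : Set Γ.E) : ℕ :=
  Nat.card (Quot (fun a b : Γ.V => ∃ e ∈ A, Γ.s e = a ∧ Γ.t e = b))

/-- The set of separating (oriented) edges: removing the underlying unoriented
edge increases the number of connected components. -/
def Esep : Set Γ.E :=
  {e | Γ.numComponents Set.univ < Γ.numComponents {f | f ≠ e ∧ f ≠ Γ.inv e}}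

/-- `T` encodes a set of unoriented edges. -/
def InvClosed (T : Set Γ.E) : Prop := ∀ e, e ∈ T ↔ Γ.inv e ∈ T

/-- `O` is (the set of positively oriented edges of) an orientation of `Γ∖T`. -/
def IsOrientation (T O : Set Γ.E) : Prop :=
  (∀ e ∈ O, e ∉ T) ∧ ∀ e, e ∉ T → (e ∈ O ↔ Γ.inv e ∉ O)

/-- A totally cyclic orientation of `Γ∖T`: an orientation such that there is no
vertex set `W` which is nonempty and proper inside some connected component of
`Γ∖T` and such that all edges of `Γ∖T` crossing the boundary of `W` are oriented
out of `W` (this is the componentwise condition of the paper). -/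
def IsTotallyCyclic (T O : Set Γ.E) : Prop :=
  Γ.IsOrientation T O ∧
    ¬ ∃ W : Set Γ.V, (∃ v ∈ W, ∃ w ∈ Wᶜ, Γ.Reach Tᶜ v w) ∧
        ∀ e ∈ O, Γ.t e ∈ W → Γ.s e ∈ W

/-- `γ` is (the set of positively oriented edges of) an oriented circuit of `Γ`:
a cyclic subgraph (connected, first Betti number one, no separating edges)
together with a totally cyclic orientation; equivalently a directed cycle:
each incident vertex has exactly one outgoing and one incoming edge in `γ`,
and the support is connected. -/
def IsCircuit (γ : Finset Γ.E) : Prop :=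
  γ.Nonempty ∧ (∀ e ∈ γ, Γ.inv e ∉ γ) ∧
    (∀ v ∈ γ.image Γ.s ∪ γ.image Γ.t, ∃! e, e ∈ γ ∧ Γ.s e = v) ∧
    (∀ v ∈ γ.image Γ.s ∪ γ.image Γ.t, ∃! e, e ∈ γ ∧ Γ.t e = v) ∧
    ∀ e ∈ γ, ∀ f ∈ γ, Γ.Reach ((↑γ : Set Γ.E) ∪ Γ.inv '' ↑γ) (Γ.s e) (Γ.s f)

/-- The class `[γ] ∈ H₁(Γ,ℤ)` of an oriented circuit. -/
def circChainZ (γ : Finset Γ.E) : Γ.E → ℤ :=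
  fun e => if e ∈ γ then 1 else if Γ.inv e ∈ γ then -1 else 0

/-- The class `[γ] ∈ H₁(Γ,ℝ)` of an oriented circuit. -/
noncomputable def circChainR (γ : Finset Γ.E) : Γ.E → ℝ :=
  fun e => (Γ.circChainZ γ e : ℝ)

/-- `Cir_φ(Γ∖T)`: oriented circuits of `Γ∖T` compatibly oriented with the
orientation with positive edges `O`. -/
def Cir (T O : Set Γ.E) : Set (Finset Γ.E) :=
  {γ | Γ.IsCircuit γ ∧ (∀ e ∈ γ, e ∈ O) ∧ ∀ e ∈ γ, e ∉ T}

/-- `c` is a 1-cycle: a skew 1-chain with vanishing boundary, i.e. an element of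
`H₁(Γ,A)`. -/
def IsCycle {A : Type*} [AddCommGroup A] (c : Γ.E → A) : Prop :=
  (∀ e, c (Γ.inv e) = - c e) ∧
    ∀ v, ∑ e ∈ Finset.univ.filter (fun e => Γ.t e = v), c e = 0

/-- An element of `H₁(Γ∖T, A) ⊆ H₁(Γ,A)`: a cycle supported on edges not in `T`. -/
def IsCycleOn {A : Type*} [AddCommGroup A] (T : Set Γ.E) (c : Γ.E → A) : Prop :=
  Γ.IsCycle c ∧ ∀ e ∈ T, c e = 0

/-- The standard positive definite bilinear form on `C⃗₁(Γ,ℝ)`, for which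
`(c, e⃗) = c e`. -/
noncomputable def pair (c c' : Γ.E → ℝ) : ℝ := (∑ e, c e * c' e) / 2

/-- The first Betti number `b₁(Γ) = dim_ℝ H₁(Γ,ℝ)`. -/
noncomputable def b1 : ℕ :=
  Module.finrank ℝ (Submodule.span ℝ {c : Γ.E → ℝ | Γ.IsCycle c})

/-- `b₁(Γ∖T) = dim_ℝ H₁(Γ∖T,ℝ)`. -/
noncomputable def b1Sub (T : Set Γ.E) : ℕ :=
  Module.finrank ℝ (Submodule.span ℝ {c : Γ.E → ℝ | Γ.IsCycleOn T c})

/-- The cone `σ(T,φ) ⊆ H₁(Γ,ℝ)` of the cographic fan associated to a pair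
`(T, O)` with `O` an orientation of `Γ∖T`. -/
def sigmaCone (T O : Set Γ.E) : Set (Γ.E → ℝ) :=
  {v | Γ.IsCycle v ∧ (∀ e ∈ O, 0 ≤ v e) ∧ ∀ e ∈ T, v e = 0}

/-- The poset `OP_Γ` of totally cyclic orientations: pairs `(T, O)` with `T` a
set of unoriented edges and `O` a totally cyclic orientation of `Γ∖T`. -/
def OP : Set (Set Γ.E × Set Γ.E) :=
  {p | Γ.InvClosed p.1 ∧ Γ.IsTotallyCyclic p.1 p.2}

/-- The order on `OP_Γ`: `(T',φ') ≤ (T,φ)` iff `T' ⊇ T` and `φ'` is the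
restriction of `φ`. -/
def OPle (p q : Set Γ.E × Set Γ.E) : Prop :=
  q.1 ⊆ p.1 ∧ p.2 = q.2 ∩ p.1ᶜ

/-- `H₁(Γ,ℤ)` viewed as the set of lattice points of `H₁(Γ,ℝ)`. -/
def H1Z : Set (Γ.E → ℝ) := {c | Γ.IsCycle c ∧ ∀ e, ∃ n : ℤ, c e = (n : ℝ)}

/-- The Voronoi polytope `Vor_Γ ⊆ H₁(Γ,ℝ)`. -/
def voronoi : Set (Γ.E → ℝ) :=
  {v | Γ.IsCycle v ∧ ∀ l ∈ Γ.H1Z, Γ.pair v v ≤ Γ.pair (v - l) (v - l)}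

/-- A (exposed) face of the Voronoi polytope. -/
def IsVorFace (F : Set (Γ.E → ℝ)) : Prop :=
  ∃ l : (Γ.E → ℝ) →ₗ[ℝ] ℝ, F = {v | v ∈ Γ.voronoi ∧ ∀ w ∈ Γ.voronoi, l w ≤ l v}

/-- The face `F(T,φ)` of the Voronoi polytope associated to `(T,O) ∈ OP_Γ`. -/
def vorFace (T O : Set Γ.E) : Set (Γ.E → ℝ) :=
  {v | v ∈ Γ.voronoi ∧ ∀ γ ∈ Γ.Cir T O,
      Γ.pair v (Γ.circChainR γ) = Γ.pair (Γ.circChainR γ) (Γ.circChainR γ) / 2}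

end SerreGraph

namespace SerreGraph

variable {Γ : SerreGraph}

lemma t_inv (e : Γ.E) : Γ.t (Γ.inv e) = Γ.s e := by
  rw [← Γ.s_inv, Γ.inv_inv]

lemma sum_comp_inv {A : Type*} [AddCommMonoid A] (g : Γ.E → A) :
    ∑ e, g (Γ.inv e) = ∑ e, g e :=
  Equiv.sum_comp (Function.Involutive.toPerm Γ.inv Γ.inv_inv) g

/-- The cycle space `H₁(Γ,ℝ)` as a subspace of the space of functions on oriented edges. -/
def cycles (Γ : SerreGraph) : Submodule ℝ (Γ.E → ℝ) where
  carrier := {c | Γ.IsCycle c}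
  add_mem' := by
    rintro a b ⟨ha, ha'⟩ ⟨hb, hb'⟩
    refine ⟨fun e => ?_, fun v => ?_⟩
    · simp only [Pi.add_apply, ha, hb]; ring
    · simp only [Pi.add_apply, Finset.sum_add_distrib, ha', hb', add_zero]
  zero_mem' := ⟨by simp, by simp⟩
  smul_mem' := by
    rintro r a ⟨ha, ha'⟩
    refine ⟨fun e => ?_, fun v => ?_⟩
    · simp only [Pi.smul_apply, ha, smul_neg]
    · simp only [Pi.smul_apply, ← Finset.smul_sum, ha', smul_zero]

/-- The pairing as a bilinear map. -/
noncomputable def pairLin (Γ : SerreGraph) : (Γ.E → ℝ) →ₗ[ℝ] (Γ.E → ℝ) →ₗ[ℝ] ℝ :=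
  LinearMap.mk₂ ℝ Γ.pair
    (fun a b c => by simp only [pair, Pi.add_apply, add_mul, Finset.sum_add_distrib, add_div])
    (fun r a b => by
      simp only [pair, Pi.smul_apply, smul_eq_mul, mul_assoc, ← Finset.mul_sum, mul_div_assoc])
    (fun a b c => by simp only [pair, Pi.add_apply, mul_add, Finset.sum_add_distrib, add_div])
    (fun r a b => by
      simp only [pair, Pi.smul_apply, smul_eq_mul, mul_left_comm _ r, ← Finset.mul_sum,
        mul_div_assoc])

@[simp] lemma pairLin_apply (a b : Γ.E → ℝ) : Γ.pairLin a b = Γ.pair a b := rfl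

lemma pair_comm (a b : Γ.E → ℝ) : Γ.pair a b = Γ.pair b a := by
  simp only [pair, mul_comm]

lemma pair_self_eq_zero {a : Γ.E → ℝ} (h : Γ.pair a a = 0) : a = 0 := by
  have h' : ∑ e, a e * a e = 0 := by unfold pair at h; linarith
  rw [Finset.sum_eq_zero_iff_of_nonneg (fun e _ => mul_self_nonneg _)] at h'
  ext e
  simpa using h' e (Finset.mem_univ _)

lemma pair_sub_sub (v l : Γ.E → ℝ) :
    Γ.pair (v - l) (v - l) = Γ.pair v v - 2 * Γ.pair v l + Γ.pair l l := by
  simp only [← pairLin_apply, map_sub, LinearMap.sub_apply]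
  simp only [pairLin_apply, pair_comm l v]
  ring

lemma mem_voronoi_iff {v : Γ.E → ℝ} :
    v ∈ Γ.voronoi ↔ Γ.IsCycle v ∧ ∀ l ∈ Γ.H1Z, Γ.pair v l ≤ Γ.pair l l / 2 := by
  refine and_congr_right fun _ => forall₂_congr fun l _ => ?_
  rw [pair_sub_sub]
  constructor <;> intro h <;> linarith

/-- Riesz representation on the cycle space. -/
lemma exists_cycle_pair_eq (l : (Γ.E → ℝ) →ₗ[ℝ] ℝ) :
    ∃ u, Γ.IsCycle u ∧ ∀ v, Γ.IsCycle v → Γ.pair u v = l v := by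
  let B : Γ.cycles →ₗ[ℝ] Module.Dual ℝ Γ.cycles := Γ.pairLin.domRestrict₁₂ Γ.cycles Γ.cycles
  have hinj : Function.Injective B := by
    rw [injective_iff_map_eq_zero]
    intro a ha
    have h : Γ.pair a a = 0 := LinearMap.congr_fun ha a
    exact Subtype.ext (pair_self_eq_zero h)
  have hsurj : Function.Surjective B :=
    (LinearMap.injective_iff_surjective_of_finrank_eq_finrank
      (Subspace.dual_finrank_eq (K := ℝ) (V := Γ.cycles)).symm).1 hinj
  obtain ⟨u, hu⟩ := hsurj (l.domRestrict Γ.cycles)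
  exact ⟨u, u.2, fun v hv => LinearMap.congr_fun hu ⟨v, hv⟩⟩

lemma IsCycle.sum_mul_t {u : Γ.E → ℝ} (hu : Γ.IsCycle u) (g : Γ.V → ℝ) :
    ∑ e, u e * g (Γ.t e) = 0 := by
  rw [← Finset.sum_fiberwise (s := Finset.univ) (g := Γ.t)]
  refine Finset.sum_eq_zero fun v _ => ?_
  have : ∀ e ∈ Finset.univ.filter (fun e => Γ.t e = v), u e * g (Γ.t e) = u e * g v := by
    intro e he
    rw [(Finset.mem_filter.1 he).2]
  rw [Finset.sum_congr rfl this, ← Finset.sum_mul, hu.2, zero_mul]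

lemma IsCycle.sum_mul_s {u : Γ.E → ℝ} (hu : Γ.IsCycle u) (g : Γ.V → ℝ) :
    ∑ e, u e * g (Γ.s e) = 0 := by
  rw [← sum_comp_inv]
  simp only [hu.1, Γ.s_inv, neg_mul, Finset.sum_neg_distrib, hu.sum_mul_t g, neg_zero]

lemma circChainR_eq {γ : Finset Γ.E} (hγ : ∀ e ∈ γ, Γ.inv e ∉ γ) (e : Γ.E) :
    Γ.circChainR γ e = (if e ∈ γ then 1 else 0) - (if Γ.inv e ∈ γ then 1 else 0) := by
  have := hγ e
  unfold circChainR circChainZ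
  split_ifs <;> simp_all

lemma circChainR_inv {γ : Finset Γ.E} (hγ : ∀ e ∈ γ, Γ.inv e ∉ γ) (e : Γ.E) :
    Γ.circChainR γ (Γ.inv e) = - Γ.circChainR γ e := by
  rw [circChainR_eq hγ, circChainR_eq hγ, Γ.inv_inv]; ring

lemma circChainR_of_mem {γ : Finset Γ.E} {e : Γ.E} (he : e ∈ γ) : Γ.circChainR γ e = 1 := by
  simp [circChainR, circChainZ, he]

lemma sum_circChainR_mul {γ : Finset Γ.E} (hγ : ∀ e ∈ γ, Γ.inv e ∉ γ) (g : Γ.E → ℝ) :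
    ∑ e, Γ.circChainR γ e * g e = ∑ e ∈ γ, (g e - g (Γ.inv e)) := by
  simp only [circChainR_eq hγ, sub_mul, Finset.sum_sub_distrib]
  congr 1
  · simp
  · rw [← sum_comp_inv]
    simp [Γ.inv_inv]

lemma boundary_circChainR {γ : Finset Γ.E} (hγ : ∀ e ∈ γ, Γ.inv e ∉ γ) (v : Γ.V) :
    ∑ e ∈ Finset.univ.filter (fun e => Γ.t e = v), Γ.circChainR γ e =
      ∑ e ∈ γ, ((if Γ.t e = v then (1 : ℝ) else 0) - (if Γ.s e = v then 1 else 0)) := by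
  have := sum_circChainR_mul hγ (fun e => if Γ.t e = v then (1 : ℝ) else 0)
  simp only [t_inv] at this
  rw [← this, Finset.sum_filter]
  simp

lemma pair_circChainR {γ : Finset Γ.E} (hγ : ∀ e ∈ γ, Γ.inv e ∉ γ) {c : Γ.E → ℝ}
    (hc : ∀ e, c (Γ.inv e) = - c e) : Γ.pair c (Γ.circChainR γ) = ∑ e ∈ γ, c e := by
  rw [pair_comm, pair, sum_circChainR_mul hγ, Finset.sum_div]
  refine Finset.sum_congr rfl fun e _ => ?_
  rw [hc]; ring

lemma pair_circChainR_self {γ : Finset Γ.E} (hγ : ∀ e ∈ γ, Γ.inv e ∉ γ) :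
    Γ.pair (Γ.circChainR γ) (Γ.circChainR γ) = γ.card := by
  rw [pair_circChainR hγ (circChainR_inv hγ),
    Finset.sum_congr rfl fun e he => circChainR_of_mem he]
  simp

lemma sum_ite_eq_one {γ : Finset Γ.E} {p : Γ.E → Prop} [DecidablePred p]
    (h : ∃! e, e ∈ γ ∧ p e) : ∑ e ∈ γ, (if p e then (1 : ℝ) else 0) = 1 := by
  obtain ⟨e, ⟨he, hp⟩, huniq⟩ := h
  rw [Finset.sum_eq_single e, if_pos hp]
  · intro b hb hne
    exact if_neg fun hpb => hne (huniq b ⟨hb, hpb⟩)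
  · exact fun h => absurd he h

lemma IsCircuit.isCycle {γ : Finset Γ.E} (h : Γ.IsCircuit γ) : Γ.IsCycle (Γ.circChainR γ) := by
  obtain ⟨-, hinv, hs, ht, -⟩ := h
  refine ⟨circChainR_inv hinv, fun v => ?_⟩
  rw [boundary_circChainR hinv, Finset.sum_sub_distrib]
  by_cases hv : v ∈ γ.image Γ.s ∪ γ.image Γ.t
  · rw [sum_ite_eq_one (hs v hv), sum_ite_eq_one (ht v hv), sub_self]
  · simp only [Finset.mem_union, Finset.mem_image, not_or, not_exists, not_and] at hv
    rw [Finset.sum_eq_zero fun e he => if_neg (hv.2 e he),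
      Finset.sum_eq_zero fun e he => if_neg (hv.1 e he), sub_self]

lemma IsCircuit.mem_H1Z {γ : Finset Γ.E} (h : Γ.IsCircuit γ) : Γ.circChainR γ ∈ Γ.H1Z :=
  ⟨h.isCycle, fun e => ⟨Γ.circChainZ γ e, rfl⟩⟩

/-- Every nonzero cycle contains a circuit in its positive support. -/
lemma exists_circuit_pos {u : Γ.E → ℝ} (hu : Γ.IsCycle u) {e₀ : Γ.E} (he₀ : 0 < u e₀) :
    ∃ γ : Finset Γ.E, Γ.IsCircuit γ ∧ ∀ e ∈ γ, 0 < u e := by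
  classical
  have step : ∀ e, 0 < u e → ∃ f, 0 < u f ∧ Γ.s f = Γ.t e := by
    intro e he
    by_contra! hcon
    have h0 := hu.2 (Γ.t e)
    have hnn : ∀ f ∈ Finset.univ.filter (fun f => Γ.t f = Γ.t e), 0 ≤ u f := by
      intro f hf
      by_contra! hneg
      exact hcon (Γ.inv f) (by rw [hu.1]; linarith)
        ((Γ.s_inv f).trans (Finset.mem_filter.1 hf).2)
    have := (Finset.sum_eq_zero_iff_of_nonneg hnn).1 h0 e (by simp)
    linarith
  have key : ∀ v : {v // ∃ e, 0 < u e ∧ Γ.s e = v}, ∃ e, 0 < u e ∧ Γ.s e = v := fun v => v.2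
  choose out hpos hsrc using key
  let next : {v // ∃ e, 0 < u e ∧ Γ.s e = v} → {v // ∃ e, 0 < u e ∧ Γ.s e = v} :=
    fun v => ⟨Γ.t (out v), step _ (hpos v)⟩
  let S : Set (Finset {v // ∃ e, 0 < u e ∧ Γ.s e = v}) :=
    {C | C.Nonempty ∧ ∀ v ∈ C, next v ∈ C}
  have hS : S.Nonempty := ⟨Finset.univ, ⟨⟨Γ.s e₀, e₀, he₀, rfl⟩, Finset.mem_univ _⟩, by simp⟩
  obtain ⟨C, hC⟩ := S.toFinite.exists_minimal hS
  obtain ⟨⟨⟨v₀, hv₀⟩, hclosed⟩, hmin⟩ := hC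
  have himg : C.image next = C := by
    have hsub : C.image next ⊆ C := by
      intro v hv
      obtain ⟨w, hw, rfl⟩ := Finset.mem_image.1 hv
      exact hclosed w hw
    refine hsub.antisymm (hmin ⟨⟨_, Finset.mem_image_of_mem _ hv₀⟩, fun v hv => ?_⟩ hsub)
    exact Finset.mem_image_of_mem _ (hsub hv)
  have hinj : Set.InjOn next C := by
    rw [← Finset.card_image_iff, himg]
  have hmemC : ∀ v ∈ (C.image out).image Γ.s ∪ (C.image out).image Γ.t, ∃ w ∈ C, w.1 = v := by
    intro v hv
    simp only [Finset.mem_union, Finset.mem_image] at hv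
    rcases hv with ⟨e, ⟨w, hw, rfl⟩, rfl⟩ | ⟨e, ⟨w, hw, rfl⟩, rfl⟩
    · exact ⟨w, hw, (hsrc w).symm⟩
    · exact ⟨next w, hclosed w hw, rfl⟩
  refine ⟨C.image out, ⟨⟨_, Finset.mem_image_of_mem _ hv₀⟩, ?_, ?_, ?_, ?_⟩, ?_⟩
  · intro e he hinv
    obtain ⟨v, hv, rfl⟩ := Finset.mem_image.1 he
    obtain ⟨w, hw, hw'⟩ := Finset.mem_image.1 hinv
    have h1 := hpos v
    have h2 := hpos w
    rw [hw', hu.1] at h2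
    linarith
  · intro v hv
    obtain ⟨w, hw, rfl⟩ := hmemC v hv
    refine ⟨out w, ⟨Finset.mem_image_of_mem _ hw, hsrc w⟩, ?_⟩
    rintro e ⟨he, hes⟩
    obtain ⟨w', hw', rfl⟩ := Finset.mem_image.1 he
    rw [hsrc] at hes
    rw [Subtype.ext hes]
  · intro v hv
    obtain ⟨w, hw, rfl⟩ := hmemC v hv
    rw [← himg] at hw
    obtain ⟨z, hz, rfl⟩ := Finset.mem_image.1 hw
    refine ⟨out z, ⟨Finset.mem_image_of_mem _ hz, rfl⟩, ?_⟩
    rintro e ⟨he, het⟩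
    obtain ⟨w', hw', rfl⟩ := Finset.mem_image.1 he
    rw [hinj hw' hz (Subtype.ext het)]
  · intro e he f hf
    obtain ⟨v, hv, rfl⟩ := Finset.mem_image.1 he
    obtain ⟨w, hw, rfl⟩ := Finset.mem_image.1 hf
    set A := (↑(C.image out) : Set Γ.E) ∪ Γ.inv '' ↑(C.image out) with hA
    rw [hsrc, hsrc]
    have hD : C ⊆ C.filter (fun z => Γ.Reach A v z) := by
      refine hmin ⟨⟨v, Finset.mem_filter.2 ⟨hv, Relation.ReflTransGen.refl⟩⟩, ?_⟩
        (Finset.filter_subset _ _)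
      intro z hz
      obtain ⟨hzC, hzr⟩ := Finset.mem_filter.1 hz
      refine Finset.mem_filter.2 ⟨hclosed z hzC, hzr.tail ⟨out z, ?_, hsrc z, rfl⟩⟩
      exact Or.inl (Finset.mem_coe.2 (Finset.mem_image_of_mem _ hzC))
    exact (Finset.mem_filter.1 (hD hw)).2
  · intro e he
    obtain ⟨v, hv, rfl⟩ := Finset.mem_image.1 he
    exact hpos v

lemma IsOrientation.mem_of_pos {T O : Set Γ.E} (hO : Γ.IsOrientation T O) {u : Γ.E → ℝ}
    (hu : u ∈ Γ.sigmaCone T O) {e : Γ.E} (he : 0 < u e) : e ∈ O := by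
  by_contra h
  have heT : e ∉ T := fun hT => he.ne' (hu.2.2 e hT)
  have h1 : Γ.inv e ∈ O := by
    by_contra h'
    exact h ((hO.2 e heT).2 h')
  have := hu.2.1 _ h1
  rw [hu.1.1] at this
  linarith

lemma IsOrientation.inv_notMem {T O : Set Γ.E} (hO : Γ.IsOrientation T O) {e : Γ.E}
    (he : e ∈ O) : Γ.inv e ∉ O :=
  (hO.2 e (hO.1 e he)).1 he

/-- Subtracting a circuit contained in the positive support keeps a cycle in the cone. -/
lemma exists_sub_circuit_mem_sigmaCone {T O : Set Γ.E} (hT : Γ.InvClosed T)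
    (hO : Γ.IsOrientation T O) {u : Γ.E → ℝ} (hu : u ∈ Γ.sigmaCone T O) {γ : Finset Γ.E}
    (hγ : Γ.IsCircuit γ) (hpos : ∀ e ∈ γ, 0 < u e) :
    ∃ ε > 0, (∃ e ∈ γ, u e = ε) ∧ u - ε • Γ.circChainR γ ∈ Γ.sigmaCone T O := by
  obtain ⟨e, he, hmin⟩ := γ.exists_min_image u hγ.1
  refine ⟨u e, hpos e he, ⟨e, he, rfl⟩, ?_, ?_, ?_⟩
  · exact Γ.cycles.sub_mem hu.1 (Γ.cycles.smul_mem _ hγ.isCycle)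
  · intro f hf
    have h2 : Γ.inv f ∉ γ := fun h =>
      hO.inv_notMem hf (hO.mem_of_pos hu (hpos _ h))
    simp only [Pi.sub_apply, Pi.smul_apply, smul_eq_mul, circChainR_eq hγ.2.1, if_neg h2]
    split_ifs with h
    · have := hmin f h
      linarith
    · have := hu.2.1 f hf
      linarith
  · intro f hf
    have h1 : f ∉ γ := fun h => (hpos f h).ne' (hu.2.2 f hf)
    have h2 : Γ.inv f ∉ γ := fun h => (hpos _ h).ne' (hu.2.2 _ ((hT f).1 hf))
    simp [circChainR_eq hγ.2.1, h1, h2, hu.2.2 f hf]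

/-- The cone `σ(T,φ)` is generated by the circuits of `Cir_φ(Γ∖T)`, in dual form. -/
lemma nonneg_of_nonneg_on_Cir {T O : Set Γ.E} (hT : Γ.InvClosed T) (hO : Γ.IsOrientation T O)
    (f : (Γ.E → ℝ) →ₗ[ℝ] ℝ) (hf : ∀ γ ∈ Γ.Cir T O, 0 ≤ f (Γ.circChainR γ))
    {u : Γ.E → ℝ} (hu : u ∈ Γ.sigmaCone T O) : 0 ≤ f u := by
  induction hn : (Finset.univ.filter fun e => 0 < u e).card using Nat.strong_induction_on
    generalizing u with
  | _ n ih =>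
    by_cases hex : ∃ e, 0 < u e
    · obtain ⟨e₀, he₀⟩ := hex
      obtain ⟨γ, hγ, hpos⟩ := exists_circuit_pos hu.1 he₀
      obtain ⟨ε, hε, ⟨e, he, hue⟩, hmem⟩ := exists_sub_circuit_mem_sigmaCone hT hO hu hγ hpos
      have hγO : ∀ e ∈ γ, e ∈ O := fun e he => hO.mem_of_pos hu (hpos e he)
      have hγC : γ ∈ Γ.Cir T O := ⟨hγ, hγO, fun e he => hO.1 e (hγO e he)⟩
      have hlt : (Finset.univ.filter fun e => 0 < (u - ε • Γ.circChainR γ) e).card < n := by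
        rw [← hn]
        refine Finset.card_lt_card ⟨fun f hf => ?_, fun hsub => ?_⟩
        · have hf' := (Finset.mem_filter.1 hf).2
          have hfO := hO.mem_of_pos hmem hf'
          have h2 : Γ.inv f ∉ γ := fun h => hO.inv_notMem hfO (hγO _ h)
          simp only [Pi.sub_apply, Pi.smul_apply, smul_eq_mul, circChainR_eq hγ.2.1,
            if_neg h2] at hf'
          refine Finset.mem_filter.2 ⟨Finset.mem_univ _, ?_⟩
          split_ifs at hf' <;> linarith
        · have := (Finset.mem_filter.1 (hsub (Finset.mem_filter.2
            ⟨Finset.mem_univ e, hpos e he⟩))).2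
          simp [circChainR_of_mem he, hue] at this
      have h1 := ih _ hlt hmem rfl
      have h2 := mul_nonneg hε.le (hf γ hγC)
      rw [map_sub, map_smul, smul_eq_mul] at h1
      linarith
    · push Not at hex
      have : u = 0 := by
        ext e
        have h1 := hex e
        have h2 := hex (Γ.inv e)
        rw [hu.1.1] at h2
        simp only [Pi.zero_apply]
        linarith
      simp [this]

lemma exists_chain_of_reach {T O : Set Γ.E} (hT : Γ.InvClosed T) (hO : Γ.IsOrientation T O)
    {v w : Γ.V} (h : Γ.Reach O v w) :
    ∃ c : Γ.E → ℝ, (∀ e, c (Γ.inv e) = - c e) ∧ (∀ e ∈ O, 0 ≤ c e) ∧ (∀ e ∈ T, c e = 0) ∧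
      ∀ z, ∑ e ∈ Finset.univ.filter (fun e => Γ.t e = z), c e =
        (if w = z then 1 else 0) - (if v = z then 1 else 0) := by
  induction h with
  | refl => exact ⟨0, by simp, by simp, by simp, by simp⟩
  | tail _ hstep ih =>
    obtain ⟨c, h1, h2, h3, h4⟩ := ih
    obtain ⟨f, hf, rfl, rfl⟩ := hstep
    have hinv : ∀ e ∈ ({f} : Finset Γ.E), Γ.inv e ∉ ({f} : Finset Γ.E) := by
      intro e he
      rw [Finset.mem_singleton] at he ⊢
      rw [he]
      exact Γ.inv_ne f
    refine ⟨c + Γ.circChainR {f}, fun e => ?_, fun e he => ?_, fun e he => ?_, fun z => ?_⟩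
    · simp only [Pi.add_apply, h1, circChainR_inv hinv]; ring
    · have hne : Γ.inv e ≠ f := by
        rintro rfl
        exact hO.inv_notMem he hf
      have := h2 e he
      simp only [Pi.add_apply, circChainR_eq hinv, Finset.mem_singleton, if_neg hne]
      split_ifs <;> linarith
    · have hne : Γ.inv e ≠ f := by
        rintro rfl
        exact hO.1 _ hf ((hT e).1 he)
      have hne' : e ≠ f := by
        rintro rfl
        exact hO.1 _ hf he
      simp [circChainR_eq hinv, hne, hne', h3 e he]
    · simp only [Pi.add_apply, Finset.sum_add_distrib, h4, boundary_circChainR hinv,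
        Finset.sum_singleton]
      ring

/-- In a totally cyclic orientation every edge lies on an oriented circuit. -/
lemma exists_mem_Cir {T O : Set Γ.E} (h : (T, O) ∈ Γ.OP) {e : Γ.E} (he : e ∈ O) :
    ∃ γ ∈ Γ.Cir T O, e ∈ γ := by
  obtain ⟨hT, hO, hW⟩ : Γ.InvClosed T ∧ Γ.IsTotallyCyclic T O := h
  have hreach : Γ.Reach O (Γ.t e) (Γ.s e) := by
    by_contra hcon
    refine hW ⟨{w | Γ.Reach O w (Γ.s e)}, ⟨Γ.s e, Relation.ReflTransGen.refl, Γ.t e, hcon,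
      Relation.ReflTransGen.single ⟨e, hO.1 e he, rfl, rfl⟩⟩, fun f hf hft => ?_⟩
    exact Relation.ReflTransGen.head ⟨f, hf, rfl, rfl⟩ hft
  obtain ⟨c, h1, h2, h3, h4⟩ := exists_chain_of_reach hT hO hreach
  have hinv : ∀ f ∈ ({e} : Finset Γ.E), Γ.inv f ∉ ({e} : Finset Γ.E) := by
    intro f hf
    rw [Finset.mem_singleton] at hf ⊢
    rw [hf]
    exact Γ.inv_ne e
  have hmem : c + Γ.circChainR {e} ∈ Γ.sigmaCone T O := by
    refine ⟨⟨fun f => ?_, fun z => ?_⟩, fun f hf => ?_, fun f hf => ?_⟩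
    · simp only [Pi.add_apply, h1, circChainR_inv hinv]; ring
    · simp only [Pi.add_apply, Finset.sum_add_distrib, h4, boundary_circChainR hinv,
        Finset.sum_singleton]
      ring
    · have hne : Γ.inv f ≠ e := by
        rintro rfl
        exact hO.inv_notMem hf he
      have := h2 f hf
      simp only [Pi.add_apply, circChainR_eq hinv, Finset.mem_singleton, if_neg hne]
      split_ifs <;> linarith
    · have hne : Γ.inv f ≠ e := by
        rintro rfl
        exact hO.1 _ he ((hT f).1 hf)
      have hne' : f ≠ e := by
        rintro rfl
        exact hO.1 _ he hf
      simp [circChainR_eq hinv, hne, hne', h3 f hf]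
  by_contra! hcon
  have := nonneg_of_nonneg_on_Cir hT hO (-LinearMap.proj e) (fun γ hγ => ?_) hmem
  · have hce := h2 e he
    simp [circChainR_of_mem (Finset.mem_singleton_self e)] at this
    linarith
  · have := hcon γ hγ
    simp only [LinearMap.neg_apply, LinearMap.proj_apply, circChainR_eq hγ.1.2.1, if_neg this]
    split_ifs <;> norm_num

open Classical in
/-- Half the signed indicator of an orientation. -/
noncomputable def halfOrientation (O : Set Γ.E) (e : Γ.E) : ℝ :=
  (if e ∈ O then 1 / 2 else 0) - (if Γ.inv e ∈ O then 1 / 2 else 0)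

lemma halfOrientation_inv (O : Set Γ.E) (e : Γ.E) :
    halfOrientation O (Γ.inv e) = - halfOrientation O e := by
  unfold halfOrientation
  rw [Γ.inv_inv]; ring

lemma abs_halfOrientation_le (O : Set Γ.E) (e : Γ.E) : |halfOrientation O e| ≤ 1 / 2 := by
  unfold halfOrientation
  split_ifs <;> norm_num [abs_of_nonneg, abs_of_nonpos]

lemma halfOrientation_of_mem {T O : Set Γ.E} (hO : Γ.IsOrientation T O) {e : Γ.E}
    (he : e ∈ O) : halfOrientation O e = 1 / 2 := by
  simp [halfOrientation, he, hO.inv_notMem he]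

lemma halfOrientation_of_notMem {O : Set Γ.E} {e : Γ.E} (he : e ∉ O) :
    halfOrientation O e ≤ 0 := by
  unfold halfOrientation
  split_ifs <;> norm_num

lemma pair_halfOrientation_le (O : Set Γ.E) {l : Γ.E → ℝ} (hl : l ∈ Γ.H1Z) :
    Γ.pair (halfOrientation O) l ≤ Γ.pair l l / 2 := by
  have : ∑ e, halfOrientation O e * l e ≤ ∑ e, l e * l e / 2 := by
    refine Finset.sum_le_sum fun e _ => ?_
    obtain ⟨n, hn⟩ := hl.2 e
    have h1 : |l e| ≤ l e * l e := by
      rw [hn, ← abs_mul_abs_self (n : ℝ)]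
      rcases eq_or_ne n 0 with rfl | h0
      · simp
      · have : (1 : ℝ) ≤ |(n : ℝ)| := by exact_mod_cast Int.one_le_abs h0
        nlinarith
    have h2 : halfOrientation O e * l e ≤ 1 / 2 * |l e| :=
      (le_abs_self _).trans ((abs_mul _ _).trans_le
        (mul_le_mul_of_nonneg_right (abs_halfOrientation_le O e) (abs_nonneg _)))
    linarith
  rw [← Finset.sum_div] at this
  unfold pair
  linarith

/-- The orthogonal projection of half an orientation to the cycle space lies in the Voronoi
polytope and detects the circuits compatible with the orientation. -/
lemma exists_voronoi_point {T O : Set Γ.E} (hO : Γ.IsOrientation T O) :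
    ∃ q ∈ Γ.voronoi, ∀ γ, Γ.IsCircuit γ →
      (Γ.pair q (Γ.circChainR γ) = Γ.pair (Γ.circChainR γ) (Γ.circChainR γ) / 2 ↔
        ∀ e ∈ γ, e ∈ O) := by
  obtain ⟨q, hq, hpair⟩ := exists_cycle_pair_eq (Γ.pairLin (halfOrientation O))
  simp only [pairLin_apply] at hpair
  refine ⟨q, mem_voronoi_iff.2 ⟨hq, fun l hl => ?_⟩, fun γ hγ => ?_⟩
  · rw [hpair l hl.1]
    exact pair_halfOrientation_le O hl
  · rw [hpair _ hγ.isCycle, pair_circChainR hγ.2.1 (halfOrientation_inv O),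
      pair_circChainR_self hγ.2.1]
    have hcard : ((γ.card : ℝ) / 2) = ∑ e ∈ γ, (1 / 2 : ℝ) := by
      rw [Finset.sum_const, nsmul_eq_mul]; ring
    rw [hcard, Finset.sum_eq_sum_iff_of_le
      (fun e _ => (le_abs_self _).trans (abs_halfOrientation_le O e))]
    refine forall₂_congr fun e _ => ⟨fun h => ?_, halfOrientation_of_mem hO⟩
    by_contra hne
    have := halfOrientation_of_notMem hne
    linarith

lemma subset_of_vorFace_eq {T O T' O' : Set Γ.E} (h : (T, O) ∈ Γ.OP) (h' : (T', O') ∈ Γ.OP)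
    (heq : Γ.vorFace T O = Γ.vorFace T' O') : O' ⊆ O := by
  intro e he
  obtain ⟨γ, hγ, heγ⟩ := exists_mem_Cir h' he
  obtain ⟨q, hq, hqγ⟩ := exists_voronoi_point h.2.1
  have hmem : q ∈ Γ.vorFace T O := ⟨hq, fun δ hδ => (hqγ δ hδ.1).2 hδ.2.1⟩
  rw [heq] at hmem
  exact (hqγ γ hγ.1).1 (hmem.2 γ hγ) e heγ

lemma mem_iff_of_mem_OP {T O : Set Γ.E} (h : (T, O) ∈ Γ.OP) (e : Γ.E) :
    e ∈ T ↔ e ∉ O ∧ Γ.inv e ∉ O := by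
  obtain ⟨hT, hO, -⟩ : Γ.InvClosed T ∧ Γ.IsTotallyCyclic T O := h
  refine ⟨fun he => ⟨fun h => hO.1 e h he, fun h => hO.1 _ h ((hT e).1 he)⟩, fun ⟨h1, h2⟩ => ?_⟩
  by_contra he
  exact h1 ((hO.2 e he).2 h2)

lemma vorFace_injOn {p p' : Set Γ.E × Set Γ.E} (h : p ∈ Γ.OP) (h' : p' ∈ Γ.OP)
    (heq : Γ.vorFace p.1 p.2 = Γ.vorFace p'.1 p'.2) : p = p' := by
  have hO : p.2 = p'.2 :=
    (subset_of_vorFace_eq h' h heq.symm).antisymm (subset_of_vorFace_eq h h' heq)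
  refine Prod.ext (Set.ext fun e => ?_) hO
  rw [mem_iff_of_mem_OP h, mem_iff_of_mem_OP h', hO]

lemma Reach.exists_crossing {A : Set Γ.E} {v w : Γ.V} (h : Γ.Reach A v w) {W : Set Γ.V}
    (hv : v ∈ W) (hw : w ∉ W) : ∃ e ∈ A, Γ.s e ∈ W ∧ Γ.t e ∉ W := by
  induction h with
  | refl => exact absurd hv hw
  | @tail b c _ hstep ih =>
    by_cases hb : b ∈ W
    · obtain ⟨e, he, rfl, rfl⟩ := hstep
      exact ⟨e, he, hb, hw⟩
    · exact ih hb

/-- The zero set and positive set of a cycle form a totally cyclic orientation. -/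
lemma IsCycle.mem_OP {u : Γ.E → ℝ} (hu : Γ.IsCycle u) :
    ({e | u e = 0}, {e | 0 < u e}) ∈ Γ.OP := by
  classical
  refine ⟨fun e => by simp [hu.1], ⟨fun e he => (ne_of_gt he : u e ≠ 0), fun e he => ?_⟩, ?_⟩
  · have : u e ≠ 0 := he
    simp only [Set.mem_ofPred_eq, hu.1, neg_pos, not_lt]
    exact ⟨le_of_lt, fun h => lt_of_le_of_ne h this.symm⟩
  · rintro ⟨W, ⟨v, hv, w, hw, hr⟩, hout⟩
    obtain ⟨e, he, hes, het⟩ := hr.exists_crossing hv hw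
    let g : Γ.V → ℝ := fun z => if z ∈ W then 1 else 0
    have hsum : ∑ e, u e * (g (Γ.s e) - g (Γ.t e)) = 0 := by
      simp only [mul_sub, Finset.sum_sub_distrib, hu.sum_mul_s g, hu.sum_mul_t g, sub_zero]
    have hnn : ∀ f ∈ Finset.univ, 0 ≤ u f * (g (Γ.s f) - g (Γ.t f)) := by
      intro f _
      have h1 : 0 < u f → Γ.t f ∈ W → Γ.s f ∈ W := hout f
      have h2 : 0 < -u f → Γ.s f ∈ W → Γ.t f ∈ W := by
        simpa [hu.1, t_inv, Γ.s_inv] using hout (Γ.inv f)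
      by_cases hs : Γ.s f ∈ W <;> by_cases ht : Γ.t f ∈ W <;>
        simp only [g, hs, ht, if_true, if_false]
      · simp
      · have : ¬ 0 < -u f := fun h => ht (h2 h hs)
        linarith
      · have : ¬ 0 < u f := fun h => hs (h1 h ht)
        linarith
      · simp
    have := (Finset.sum_eq_zero_iff_of_nonneg hnn).1 hsum e (Finset.mem_univ _)
    simp only [g, hes, het, if_true, if_false, sub_zero, mul_one] at this
    exact he this

/-- The face of the Voronoi polytope exposed by a cycle. -/
lemma IsCycle.exposedFace_eq {u : Γ.E → ℝ} (hu : Γ.IsCycle u) :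
    {v | v ∈ Γ.voronoi ∧ ∀ w ∈ Γ.voronoi, Γ.pair u w ≤ Γ.pair u v} =
      Γ.vorFace {e | u e = 0} {e | 0 < u e} := by
  obtain ⟨hT, hO, -⟩ := hu.mem_OP
  dsimp only at hT hO
  have hσ : u ∈ Γ.sigmaCone {e | u e = 0} {e | 0 < u e} :=
    ⟨hu, fun e he => le_of_lt he, fun e he => he⟩
  obtain ⟨q, hq, hqγ⟩ := exists_voronoi_point hO
  have hle : ∀ v ∈ Γ.voronoi, ∀ γ ∈ Γ.Cir {e | u e = 0} {e | 0 < u e},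
      Γ.pair v (Γ.circChainR γ) ≤ Γ.pair q (Γ.circChainR γ) := fun v hv γ hγ => by
    rw [(hqγ γ hγ.1).2 hγ.2.1]
    exact (mem_voronoi_iff.1 hv).2 _ hγ.1.mem_H1Z
  have hcone : ∀ v ∈ Γ.voronoi, ∀ c ∈ Γ.sigmaCone {e | u e = 0} {e | 0 < u e},
      Γ.pair v c ≤ Γ.pair q c := fun v hv c hc => by
    have := nonneg_of_nonneg_on_Cir hT hO (Γ.pairLin q - Γ.pairLin v)
      (fun γ hγ => sub_nonneg.2 (hle v hv γ hγ)) hc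
    exact sub_nonneg.1 this
  ext v
  refine and_congr_right fun hv => ⟨fun hmax γ hγ => ?_, fun hγ w hw => ?_⟩
  · obtain ⟨ε, hε, -, hmem⟩ := exists_sub_circuit_mem_sigmaCone hT hO hσ hγ.1 hγ.2.1
    have h1 := hcone v hv _ hmem
    have h2 := hle v hv γ hγ
    have h3 := hmax q hq
    simp only [← pairLin_apply, map_sub, map_smul, smul_eq_mul] at h1
    simp only [pairLin_apply] at h1
    rw [pair_comm u q, pair_comm u v] at h3
    rw [← (hqγ γ hγ.1).2 hγ.2.1]
    refine h2.antisymm (le_of_mul_le_mul_left ?_ hε)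
    linarith
  · have h1 := hcone w hw u hσ
    have h2 : 0 ≤ (Γ.pairLin v - Γ.pairLin q) u :=
      nonneg_of_nonneg_on_Cir hT hO _ (fun γ hγ' => by
        rw [LinearMap.sub_apply, pairLin_apply, pairLin_apply, hγ γ hγ',
          (hqγ γ hγ'.1).2 hγ'.2.1, sub_self]) hσ
    have h3 : Γ.pair q u ≤ Γ.pair v u := sub_nonneg.1 h2
    rw [pair_comm u w, pair_comm u v]
    exact h1.trans h3

end SerreGraph

/-- Every face of the Voronoi polytope `Vor_Γ` equals `F(T,φ)`
for a uniquely determined `(T,φ) ∈ OP_Γ`. -/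
theorem stmt11 (Γ : SerreGraph) (F : Set (Γ.E → ℝ)) (hF : Γ.IsVorFace F) :
    ∃! p : {p : Set Γ.E × Set Γ.E // p ∈ Γ.OP}, F = Γ.vorFace p.1.1 p.1.2 := by
  obtain ⟨l, rfl⟩ := hF
  obtain ⟨u, hu, hul⟩ := SerreGraph.exists_cycle_pair_eq l
  have hface : {v | v ∈ Γ.voronoi ∧ ∀ w ∈ Γ.voronoi, l w ≤ l v} =
      Γ.vorFace {e | u e = 0} {e | 0 < u e} := by
    rw [← hu.exposedFace_eq]
    ext v
    refine and_congr_right fun hv => forall₂_congr fun w hw => ?_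
    rw [hul v hv.1, hul w hw.1]
  refine ⟨⟨_, hu.mem_OP⟩, hface, fun p hp => Subtype.ext ?_⟩
  exact SerreGraph.vorFace_injOn p.2 hu.mem_OP (hp.symm.trans hface)
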